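/- Let κ ∈ ℂ with Re(κ) < 1 and let 0 < r₀ < r be real numbers. Then the series (1/(r r₀)) Σ_{ℓ=0}^∞ (Γ(ℓ+1−κ)/(2ℓ)!) · M_{κ,ℓ+1/2}(r₀) · W_{κ,ℓ+1/2}(r) converges, and its sum equals (Γ(1−κ)/(r−r₀)) · ( M′_{κ,1/2}(r₀) · W_{κ,1/2}(r) − M_{κ,1/2}(r₀) · W′_{κ,1/2}(r) ), where the primes denote derivatives with respect to the argument. -/

import Mathlib

open scoped BigOperators
open MeasureTheory

noncomputable section

/-- Ascending Pochhammer symbol `(a)_n = a (a+1) ⋯ (a+n-1)`. -/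
def aP (n : ℕ) (a : ℂ) : ℂ := (ascPochhammer ℂ n).eval a

/-- The Whittaker function `M_{κ, ℓ+1/2}` as an entire function of `z`:
`M_{κ,ℓ+1/2}(z) = e^{-z/2} z^{ℓ+1} ∑_{n} ((ℓ+1-κ)_n / ((2ℓ+2)_n n!)) z^n`. -/
def whittakerM (κ : ℂ) (ℓ : ℕ) (z : ℂ) : ℂ :=
  Complex.exp (-z / 2) * z ^ (ℓ + 1) *
    ∑' n : ℕ, aP n ((ℓ : ℂ) + 1 - κ) / (aP n (2 * (ℓ : ℂ) + 2) * (n.factorial : ℂ)) * z ^ n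

/-- The Whittaker function `W_{κ,μ}(r)` for `r > 0`, `Re(μ-κ+1/2) > 0`, defined by the integral
representation `W_{κ,μ}(r) = e^{-r/2} r^κ Γ(μ-κ+1/2)⁻¹ ∫_0^∞ t^{μ-κ-1/2} (1+t/r)^{μ+κ-1/2} e^{-t} dt`. -/
def whittakerW (κ μ : ℂ) (r : ℝ) : ℂ :=
  Complex.exp (-(r : ℂ) / 2) * (r : ℂ) ^ κ * (Complex.Gamma (μ - κ + 1 / 2))⁻¹ *
    ∫ t in Set.Ioi (0 : ℝ),
      (t : ℂ) ^ (μ - κ - 1 / 2) * ((1 + t / r : ℝ) : ℂ) ^ (μ + κ - 1 / 2) * Complex.exp (-(t : ℂ))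


/-! ### Kummer's confluent hypergeometric series -/

/-- The `n`-th term of Kummer's series `M(a, b, z)`. -/
def kummerTerm (a b z : ℂ) (n : ℕ) : ℂ := aP n a / (aP n b * (n.factorial : ℂ)) * z ^ n

/-- Kummer's function `M(a, b, z)`, defined by its power series. -/
def kummer (a b z : ℂ) : ℂ := ∑' n, kummerTerm a b z n

lemma aP_zero (a : ℂ) : aP 0 a = 1 := by simp [aP]

lemma aP_succ (n : ℕ) (a : ℂ) : aP (n + 1) a = aP n a * (a + n) := by
  simp [aP, ascPochhammer_succ_eval]

lemma aP_succ_left (n : ℕ) (a : ℂ) : aP (n + 1) a = a * aP n (a + 1) := by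
  induction n with
  | zero => simp [aP_succ, aP_zero]
  | succ n ih => rw [aP_succ, ih, aP_succ]; push_cast; ring

lemma add_natCast_ne_zero {b : ℂ} (hb : 1 ≤ b.re) (n : ℕ) : b + n ≠ 0 := by
  intro h
  have := congrArg Complex.re h
  simp at this
  linarith [n.cast_nonneg (α := ℝ)]

lemma aP_ne_zero {b : ℂ} (hb : 1 ≤ b.re) (n : ℕ) : aP n b ≠ 0 := by
  induction n with
  | zero => simp [aP_zero]
  | succ n ih => rw [aP_succ]; exact mul_ne_zero ih (add_natCast_ne_zero hb n)

lemma norm_aP_le {a b : ℂ} {C : ℝ} (hC : 0 ≤ C) (h : ∀ k : ℕ, ‖a + k‖ ≤ C * ‖b + k‖) (n : ℕ) :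
    ‖aP n a‖ ≤ C ^ n * ‖aP n b‖ := by
  induction n with
  | zero => simp [aP_zero]
  | succ n ih =>
    rw [aP_succ, aP_succ, norm_mul, norm_mul]
    calc ‖aP n a‖ * ‖a + n‖ ≤ (C ^ n * ‖aP n b‖) * (C * ‖b + n‖) := by
          gcongr
          exact h n
      _ = _ := by ring

lemma norm_kummerTerm_le {a b : ℂ} (hb : 1 ≤ b.re) {C : ℝ} (hC : 0 ≤ C)
    (h : ∀ k : ℕ, ‖a + k‖ ≤ C * ‖b + k‖) (z : ℂ) (n : ℕ) :
    ‖kummerTerm a b z n‖ ≤ (C * ‖z‖) ^ n / n.factorial := by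
  have h0 : 0 < ‖aP n b‖ := norm_pos_iff.2 (aP_ne_zero hb n)
  have h1 : (0 : ℝ) < n.factorial := by positivity
  rw [kummerTerm, norm_mul, norm_div, norm_mul, norm_pow, Complex.norm_natCast, mul_pow,
    div_mul_eq_mul_div, div_le_div_iff₀ (by positivity) h1]
  calc ‖aP n a‖ * ‖z‖ ^ n * n.factorial
      ≤ (C ^ n * ‖aP n b‖) * ‖z‖ ^ n * n.factorial := by
        gcongr
        exact norm_aP_le hC h n
    _ = _ := by ring

lemma norm_add_natCast_le {b : ℂ} (hb : 1 ≤ b.re) (a : ℂ) (k : ℕ) :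
    ‖a + k‖ ≤ (1 + ‖a‖) * ‖b + k‖ := by
  have h1 : (1 : ℝ) + k ≤ ‖b + k‖ := by
    refine le_trans ?_ (Complex.re_le_norm _)
    simpa using hb
  have h2 : ‖a + k‖ ≤ ‖a‖ + k := by simpa using norm_add_le a (k : ℂ)
  have h3 : (1 + ‖a‖) * (1 + k) ≤ (1 + ‖a‖) * ‖b + k‖ := by gcongr
  nlinarith [norm_nonneg a, k.cast_nonneg (α := ℝ), mul_nonneg (norm_nonneg a) (k.cast_nonneg (α := ℝ))]

lemma norm_kummerTerm_le_one_add_norm {b : ℂ} (hb : 1 ≤ b.re) (a z : ℂ) (n : ℕ) :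
    ‖kummerTerm a b z n‖ ≤ ((1 + ‖a‖) * ‖z‖) ^ n / n.factorial :=
  norm_kummerTerm_le hb (by positivity) (norm_add_natCast_le hb a) z n

lemma summable_kummerTerm {b : ℂ} (hb : 1 ≤ b.re) (a z : ℂ) : Summable (kummerTerm a b z) :=
  .of_norm_bounded (Real.summable_pow_div_factorial _) (norm_kummerTerm_le_one_add_norm hb a z)

lemma norm_kummer_le_exp {a b : ℂ} (hb : 1 ≤ b.re) (h : ∀ k : ℕ, ‖a + k‖ ≤ ‖b + k‖) (z : ℂ) :
    ‖kummer a b z‖ ≤ Real.exp ‖z‖ := by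
  have hsum := NormedSpace.expSeries_div_hasSum_exp (𝔸 := ℝ) ‖z‖
  rw [← Real.exp_eq_exp_ℝ] at hsum
  refine tsum_of_norm_bounded hsum fun n => ?_
  simpa using norm_kummerTerm_le hb zero_le_one (by simpa using h) z n

lemma tsum_eq_add_mul_tsum_of_succ {u v w : ℕ → ℂ} {c : ℂ} (hu : Summable u) (hv : Summable v)
    (h0 : u 0 = v 0) (h : ∀ n, u (n + 1) = v (n + 1) + c * w n) :
    ∑' n, u n = ∑' n, v n + c * ∑' n, w n := by
  rw [hu.tsum_eq_zero_add, hv.tsum_eq_zero_add, h0, ← tsum_mul_left, add_assoc]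
  have hu' := (summable_nat_add_iff 1).2 hu
  have hv' := (summable_nat_add_iff 1).2 hv
  have hw : Summable fun n => c * w n := by
    refine (hu'.sub hv').congr fun n => ?_
    rw [h n]; ring
  rw [← hv'.tsum_add hw]
  simp_rw [h]

lemma kummer_add_one_add_one {b : ℂ} (hb : 1 ≤ b.re) (a z : ℂ) :
    kummer (a + 1) (b + 1) z =
      kummer a b z + (b - a) / (b * (b + 1)) * z * kummer (a + 1) (b + 2) z := by
  refine tsum_eq_add_mul_tsum_of_succ (summable_kummerTerm (by simp; linarith) _ _)
    (summable_kummerTerm hb _ _) (by simp [kummerTerm, aP_zero]) fun n => ?_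
  have e1 : aP (n + 1) a = a * aP n (a + 1) := aP_succ_left n a
  have e2 : aP (n + 1) (b + 1) = (b + 1) * aP n (b + 2) := by
    rw [aP_succ_left]; ring_nf
  have e3 : aP (n + 1) b * (b + 1 + n) = b * ((b + 1) * aP n (b + 2)) := by
    rw [aP_succ_left, mul_assoc, ← aP_succ, e2]
  have h0 : b ≠ 0 := by simpa using add_natCast_ne_zero hb 0
  have h1 : b + 1 ≠ 0 := by simpa using add_natCast_ne_zero hb 1
  have h2 : b + 1 + n ≠ 0 := by
    have := add_natCast_ne_zero hb (n + 1); push_cast at this; rwa [add_assoc, add_comm 1 (n : ℂ)]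
  have h3 : aP n (b + 2) ≠ 0 := aP_ne_zero (by simp; linarith) n
  have h4 : (n.factorial : ℂ) ≠ 0 := by exact_mod_cast n.factorial_ne_zero
  have h5 : (n + 1 : ℂ) ≠ 0 := by exact_mod_cast n.succ_ne_zero
  rw [← eq_div_iff h2] at e3
  simp only [kummerTerm]
  rw [e3, e2, e1, aP_succ, Nat.factorial_succ]
  push_cast
  field_simp
  ring

lemma kummer_eq_add_one {b : ℂ} (hb : 1 ≤ b.re) (a z : ℂ) :
    kummer a b z = kummer a (b + 1) z + a / (b * (b + 1)) * z * kummer (a + 1) (b + 2) z := by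
  refine tsum_eq_add_mul_tsum_of_succ (summable_kummerTerm hb _ _)
    (summable_kummerTerm (by simp; linarith) _ _) (by simp [kummerTerm, aP_zero]) fun n => ?_
  have e1 : aP (n + 1) a = a * aP n (a + 1) := aP_succ_left n a
  have e2 : aP (n + 1) (b + 1) = (b + 1) * aP n (b + 2) := by
    rw [aP_succ_left]; ring_nf
  have e3 : aP (n + 1) b * (b + 1 + n) = b * ((b + 1) * aP n (b + 2)) := by
    rw [aP_succ_left, mul_assoc, ← aP_succ, e2]
  have h0 : b ≠ 0 := by simpa using add_natCast_ne_zero hb 0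
  have h1 : b + 1 ≠ 0 := by simpa using add_natCast_ne_zero hb 1
  have h2 : b + 1 + n ≠ 0 := by
    have := add_natCast_ne_zero hb (n + 1); push_cast at this; rwa [add_assoc, add_comm 1 (n : ℂ)]
  have h3 : aP n (b + 2) ≠ 0 := aP_ne_zero (by simp; linarith) n
  have h4 : (n.factorial : ℂ) ≠ 0 := by exact_mod_cast n.factorial_ne_zero
  have h5 : (n + 1 : ℂ) ≠ 0 := by exact_mod_cast n.succ_ne_zero
  rw [← eq_div_iff h2] at e3
  simp only [kummerTerm]
  rw [e3, e2, e1, Nat.factorial_succ]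
  push_cast
  field_simp
  ring

/-- The three-term recurrence of Kummer's function along the direction `(1, 2)`. -/
lemma kummer_three_term {b : ℂ} (hb : 1 ≤ b.re) (a z : ℂ) :
    kummer a b z =
      (1 + (a + 1) / ((b + 1) * (b + 2)) * z - (b - a) / (b * (b + 1)) * z) *
        kummer (a + 1) (b + 2) z +
      (a + 1) * (b + 1 - a) / ((b + 1) * (b + 2) ^ 2 * (b + 3)) * z ^ 2 *
        kummer (a + 2) (b + 4) z := by
  have h1 := kummer_add_one_add_one hb a z
  have h2 := kummer_eq_add_one (b := b + 1) (by simp; linarith) (a + 1) z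
  have h3 := kummer_add_one_add_one (b := b + 2) (by simp; linarith) (a + 1) z
  have n0 : b ≠ 0 := by simpa using add_natCast_ne_zero hb 0
  have n1 : b + 1 ≠ 0 := by simpa using add_natCast_ne_zero hb 1
  have n2 : b + 2 ≠ 0 := by simpa using add_natCast_ne_zero hb 2
  have n3 : b + 3 ≠ 0 := by simpa using add_natCast_ne_zero hb 3
  simp only [add_assoc] at h1 h2 h3
  norm_num at h1 h2 h3
  rw [h2, h3] at h1
  rw [← sub_eq_zero] at h1 ⊢
  rw [← neg_eq_zero, ← h1]
  field_simp
  ring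

lemma hasDerivAt_kummer {b : ℂ} (hb : 1 ≤ b.re) (a z : ℂ) :
    HasDerivAt (kummer a b) (a / b * kummer (a + 1) (b + 1) z) z := by
  have hu := Real.summable_pow_div_factorial ((1 + ‖a‖) * (‖z‖ + 1))
  have hd (n : ℕ) : DifferentiableOn ℂ (fun w => kummerTerm a b w n) (Metric.ball 0 (‖z‖ + 1)) := by
    unfold kummerTerm; fun_prop
  have hle (n : ℕ) (w : ℂ) (hw : w ∈ Metric.ball 0 (‖z‖ + 1)) :
      ‖kummerTerm a b w n‖ ≤ ((1 + ‖a‖) * (‖z‖ + 1)) ^ n / n.factorial := by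
    refine (norm_kummerTerm_le_one_add_norm hb a w n).trans ?_
    have : ‖w‖ < ‖z‖ + 1 := by simpa using hw
    gcongr
  have hz : z ∈ Metric.ball 0 (‖z‖ + 1) := by simp
  have hS := Complex.hasSum_deriv_of_summable_norm hu hd Metric.isOpen_ball hle hz
  have hD : DifferentiableAt ℂ (kummer a b) z :=
    (Complex.differentiableOn_tsum_of_summable_norm hu hd Metric.isOpen_ball hle).differentiableAt
      (Metric.isOpen_ball.mem_nhds hz)
  have hs := hS.summable
  have hT : deriv (kummer a b) z = a / b * kummer (a + 1) (b + 1) z := by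
    refine hS.tsum_eq.symm.trans ?_
    rw [hs.tsum_eq_zero_add, kummer, ← tsum_mul_left]
    have : deriv (fun w => kummerTerm a b w 0) z = 0 := by simp [kummerTerm]
    rw [this, zero_add]
    refine tsum_congr fun n => ?_
    have h1 : deriv (fun w => kummerTerm a b w (n + 1)) z =
        aP (n + 1) a / (aP (n + 1) b * ((n + 1).factorial : ℂ)) * ((n + 1 : ℕ) * z ^ n) := by
      simp [kummerTerm]
    have h0 : b ≠ 0 := by simpa using add_natCast_ne_zero hb 0
    have h3 : aP n (b + 1) ≠ 0 := aP_ne_zero (by simp; linarith) n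
    have h4 : (n.factorial : ℂ) ≠ 0 := by exact_mod_cast n.factorial_ne_zero
    have h5 : (n + 1 : ℂ) ≠ 0 := by exact_mod_cast n.succ_ne_zero
    rw [h1, aP_succ_left, aP_succ_left, Nat.factorial_succ, kummerTerm]
    push_cast
    field_simp
  exact hT ▸ hD.hasDerivAt

/-! ### The Laplace-type integral of the second Whittaker function -/

/-- The integral `∫_0^∞ t^p (1 + t/r)^q e^{-t} dt`. -/
def tricomiIntegral (r : ℝ) (p q : ℂ) : ℂ :=
  ∫ t in Set.Ioi (0 : ℝ), (t : ℂ) ^ p * ((1 + t / r : ℝ) : ℂ) ^ q * Complex.exp (-(t : ℂ))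

lemma one_add_div_pos {r t : ℝ} (hr : 0 < r) (ht : 0 ≤ t) : 0 < 1 + t / r := by positivity

lemma one_add_div_ne_zero {r t : ℝ} (hr : 0 < r) (ht : 0 ≤ t) : ((1 + t / r : ℝ) : ℂ) ≠ 0 :=
  Complex.ofReal_ne_zero.2 (one_add_div_pos hr ht).ne'

lemma norm_tricomiIntegrand {r t : ℝ} (hr : 0 < r) (ht : 0 < t) (p q : ℂ) :
    ‖(t : ℂ) ^ p * ((1 + t / r : ℝ) : ℂ) ^ q * Complex.exp (-(t : ℂ))‖ =
      t ^ p.re * (1 + t / r) ^ q.re * Real.exp (-t) := by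
  rw [norm_mul, norm_mul, Complex.norm_cpow_eq_rpow_re_of_pos ht,
    Complex.norm_cpow_eq_rpow_re_of_pos (one_add_div_pos hr ht.le), Complex.norm_exp]
  simp

lemma integrableOn_rpow_mul_one_add_div_rpow_mul_exp {r s p q : ℝ} (hr : 0 < r) (hs : 0 < s)
    (hp : -1 < p) :
    IntegrableOn (fun t : ℝ => t ^ p * (1 + t / r) ^ q * Real.exp (-s * t)) (Set.Ioi 0) := by
  obtain ⟨N, hN⟩ := exists_nat_ge q
  set D : ℝ := N.factorial / (s * r / 2) ^ N * Real.exp (s * r / 2) with hD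
  have hI := (integrableOn_rpow_mul_exp_neg_mul_rpow (p := 1) (b := s / 2) hp one_pos
    (by positivity)).const_mul D
  refine Integrable.mono' hI (by fun_prop) ?_
  refine (ae_restrict_iff' measurableSet_Ioi).2 (.of_forall fun t ht => ?_)
  have ht : 0 < t := ht
  have h1 : (1 + t / r) ^ q ≤ D * Real.exp (s / 2 * t) := by
    have h2 : (1 + t / r) ^ q ≤ (1 + t / r) ^ N := by
      rw [← Real.rpow_natCast]
      exact Real.rpow_le_rpow_of_exponent_le (by simp; positivity) hN
    have h3 := Real.pow_div_factorial_le_exp (s * r / 2 * (1 + t / r)) (by positivity) N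
    have h4 : s * r / 2 * (1 + t / r) = s * r / 2 + s / 2 * t := by field_simp
    rw [div_le_iff₀ (by positivity), mul_pow, h4, Real.exp_add] at h3
    refine h2.trans ?_
    rw [hD, div_mul_eq_mul_div, div_mul_eq_mul_div, le_div_iff₀ (by positivity)]
    linarith
  rw [Real.norm_of_nonneg (by positivity)]
  calc t ^ p * (1 + t / r) ^ q * Real.exp (-s * t)
      ≤ t ^ p * (D * Real.exp (s / 2 * t)) * Real.exp (-s * t) := by gcongr
    _ = D * (t ^ p * (Real.exp (s / 2 * t) * Real.exp (-s * t))) := by ring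
    _ = _ := by rw [← Real.exp_add, Real.rpow_one]; ring_nf

lemma aestronglyMeasurable_tricomiIntegrand (r : ℝ) (p q : ℂ) (μ : Measure ℝ) :
    AEStronglyMeasurable (fun t : ℝ =>
      (t : ℂ) ^ p * ((1 + t / r : ℝ) : ℂ) ^ q * Complex.exp (-(t : ℂ))) μ := by
  fun_prop

lemma integrableOn_tricomiIntegrand {r : ℝ} {p : ℂ} (hr : 0 < r) (hp : -1 < p.re) (q : ℂ) :
    IntegrableOn (fun t : ℝ =>
      (t : ℂ) ^ p * ((1 + t / r : ℝ) : ℂ) ^ q * Complex.exp (-(t : ℂ))) (Set.Ioi 0) := by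
  refine Integrable.mono' (integrableOn_rpow_mul_one_add_div_rpow_mul_exp (q := q.re) hr one_pos hp)
    (aestronglyMeasurable_tricomiIntegrand r p q _) ?_
  refine (ae_restrict_iff' measurableSet_Ioi).2 (.of_forall fun t ht => ?_)
  rw [norm_tricomiIntegrand hr ht]
  simp

lemma tricomiIntegral_add_one_right {r : ℝ} {p : ℂ} (hr : 0 < r) (hp : -1 < p.re) (q : ℂ) :
    tricomiIntegral r p (q + 1) = tricomiIntegral r p q + tricomiIntegral r (p + 1) q / r := by
  unfold tricomiIntegral
  rw [← integral_div, ← integral_add (integrableOn_tricomiIntegrand hr hp q)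
    ((integrableOn_tricomiIntegrand hr (by simp; linarith) q).div_const _)]
  refine setIntegral_congr_fun measurableSet_Ioi fun t (ht : 0 < t) => ?_
  rw [Complex.cpow_add _ _ (one_add_div_ne_zero hr ht.le),
    Complex.cpow_add _ _ (Complex.ofReal_ne_zero.2 ht.ne'), Complex.cpow_one, Complex.cpow_one]
  push_cast
  ring

lemma hasDerivAt_one_add_div_cpow {r t : ℝ} (hr : 0 < r) (ht : 0 ≤ t) (q : ℂ) :
    HasDerivAt (fun t : ℝ => ((1 + t / r : ℝ) : ℂ) ^ (q + 1))
      ((q + 1) * ((1 + t / r : ℝ) : ℂ) ^ q / r) t := by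
  have h1 : HasDerivAt (fun t : ℝ => 1 + t / r) (1 / r) t :=
    ((hasDerivAt_id t).div_const r).const_add 1
  have h2 : HasDerivAt (fun z : ℂ => z ^ (q + 1))
      ((q + 1) * ((1 + t / r : ℝ) : ℂ) ^ (q + 1 - 1) * 1) ((1 + t / r : ℝ) : ℂ) :=
    (hasDerivAt_id _).cpow_const (Complex.ofReal_mem_slitPlane.2 (one_add_div_pos hr ht))
  have h3 := h2.scomp t h1.ofReal_comp
  refine h3.congr_deriv ?_
  simp
  ring

/-- Integration by parts. -/
lemma tricomiIntegral_add_one_add_one {r : ℝ} {p : ℂ} (hr : 0 < r) (hp : -1 < p.re) (q : ℂ) :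
    tricomiIntegral r (p + 1) (q + 1) =
      (p + 1) * tricomiIntegral r p (q + 1) + (q + 1) / r * tricomiIntegral r (p + 1) q := by
  set f : ℝ → ℂ := fun t =>
    (t : ℂ) ^ (p + 1) * ((1 + t / r : ℝ) : ℂ) ^ (q + 1) * Complex.exp (-(t : ℂ)) with hf
  have hp1 : -1 < (p + 1).re := by simp; linarith
  have hp0 : p + 1 ≠ 0 := by
    intro h
    have := congrArg Complex.re h
    simp at this; linarith
  have i1 := (integrableOn_tricomiIntegrand hr hp (q + 1)).const_mul (p + 1)
  have i2 := (integrableOn_tricomiIntegrand hr hp1 q).const_mul ((q + 1) / r)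
  have i3 := integrableOn_tricomiIntegrand hr hp1 (q + 1)
  have hderiv : ∀ t ∈ Set.Ioi (0 : ℝ), HasDerivAt f
      ((p + 1) * ((t : ℂ) ^ p * ((1 + t / r : ℝ) : ℂ) ^ (q + 1) * Complex.exp (-(t : ℂ))) +
        (q + 1) / r * ((t : ℂ) ^ (p + 1) * ((1 + t / r : ℝ) : ℂ) ^ q * Complex.exp (-(t : ℂ))) -
        f t) t := by
    intro t ht
    have ht : 0 < t := ht
    have d1 := hasDerivAt_ofReal_cpow_const ht.ne' hp0
    have d2 := hasDerivAt_one_add_div_cpow hr ht.le q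
    have d3 : HasDerivAt (fun t : ℝ => Complex.exp (-(t : ℂ))) (-Complex.exp (-(t : ℂ))) t := by
      have := (Complex.ofRealCLM.hasDerivAt (x := t)).neg.cexp
      simpa using this
    refine ((d1.mul d2).mul d3).congr_deriv ?_
    simp only [hf, add_sub_cancel_right, Pi.mul_apply]
    ring
  have hcont : ContinuousWithinAt f (Set.Ici 0) 0 := by
    have c1 : ContinuousAt (fun t : ℝ => (t : ℂ) ^ (p + 1)) 0 :=
      Complex.continuousAt_ofReal_cpow_const 0 (p + 1) (.inl (by simp; linarith))
    have c2 := (hasDerivAt_one_add_div_cpow hr le_rfl q).continuousAt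
    exact ((c1.mul c2).mul (by fun_prop)).continuousWithinAt
  have hlim := tendsto_zero_of_hasDerivAt_of_integrableOn_Ioi hderiv ((i1.add i2).sub i3) i3
  have key := integral_Ioi_of_hasDerivAt_of_tendsto hcont hderiv ((i1.add i2).sub i3) hlim
  have i12 : Integrable (fun t : ℝ =>
      (p + 1) * ((t : ℂ) ^ p * ((1 + t / r : ℝ) : ℂ) ^ (q + 1) * Complex.exp (-(t : ℂ))) +
        (q + 1) / r * ((t : ℂ) ^ (p + 1) * ((1 + t / r : ℝ) : ℂ) ^ q * Complex.exp (-(t : ℂ))))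
      (volume.restrict (Set.Ioi 0)) := i1.add i2
  rw [integral_sub i12 i3, integral_add i1 i2, integral_const_mul, integral_const_mul] at key
  have hf0 : f 0 = 0 := by simp [hf, hp0]
  rw [hf0, sub_zero] at key
  exact (sub_eq_zero.1 key).symm

lemma tricomiIntegral_add_one_left {r : ℝ} {p : ℂ} (hr : 0 < r) (hp : -1 < p.re) (q : ℂ) :
    tricomiIntegral r (p + 1) (q + 1) =
      (p + q + 2) * tricomiIntegral r p (q + 1) - (q + 1) * tricomiIntegral r p q := by
  rw [tricomiIntegral_add_one_add_one hr hp, tricomiIntegral_add_one_right hr hp]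
  ring

lemma tricomiIntegral_succ {r : ℝ} {p : ℂ} (hr : 0 < r) (hp : -1 < p.re) (q : ℂ) :
    tricomiIntegral r (p + 1) (q + 1) =
      (p + 1) * tricomiIntegral r p q + (p + q + 2) / r * tricomiIntegral r (p + 1) q := by
  rw [tricomiIntegral_add_one_add_one hr hp, tricomiIntegral_add_one_right hr hp]
  ring

/-- The three-term recurrence of the Laplace-type integral along the direction `(1, 1)`. -/
lemma tricomiIntegral_three_term {r : ℝ} {p q : ℂ} (hr : 0 < r) (hp : -1 < p.re)
    (h2 : p + q + 2 ≠ 0) (h4 : p + q + 4 ≠ 0) :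
    tricomiIntegral r (p + 2) (q + 2) / (p + q + 4) =
      (p + 1) * (q + 1) / (p + q + 2) * tricomiIntegral r p q +
      ((p + q + 3) / r - (q + 1) / (p + q + 2) + (p + 2) / (p + q + 4)) *
        tricomiIntegral r (p + 1) (q + 1) := by
  have hp1 : -1 < (p + 1).re := by simp; linarith
  have e1 := tricomiIntegral_succ hr hp q
  have e2 := tricomiIntegral_succ hr hp1 (q + 1)
  have e3 := tricomiIntegral_add_one_left hr hp1 q
  have hr' : (r : ℂ) ≠ 0 := Complex.ofReal_ne_zero.2 hr.ne'
  have a1 : p + 1 + (q + 1) + 2 = p + q + 4 := by ring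
  have a2 : p + 1 + q + 2 = p + q + 3 := by ring
  have a3 : p + 1 + 1 = p + 2 := by ring
  have a4 : q + 1 + 1 = q + 2 := by ring
  rw [a1, a3, a4] at e2
  rw [a2, a3] at e3
  have e4 : tricomiIntegral r (p + 1) q =
      r / (p + q + 2) * (tricomiIntegral r (p + 1) (q + 1) - (p + 1) * tricomiIntegral r p q) := by
    rw [e1]; field_simp; ring
  rw [e2, e3, e4]
  field_simp
  ring

lemma hasDerivAt_tricomiIntegral {r : ℝ} {p q : ℂ} (hr : 0 < r) (hp : -1 < p.re)
    (hq : q.re ≤ 0) :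
    HasDerivAt (fun r => tricomiIntegral r p (q + 1))
      (-(q + 1) / r ^ 2 * tricomiIntegral r (p + 1) q) r := by
  have hp1 : -1 < (p + 1).re := by simp; linarith
  set F' : ℝ → ℝ → ℂ := fun s t =>
    -(q + 1) / s ^ 2 * ((t : ℂ) ^ (p + 1) * ((1 + t / s : ℝ) : ℂ) ^ q * Complex.exp (-(t : ℂ)))
    with hF'
  have hb := (integrableOn_rpow_mul_one_add_div_rpow_mul_exp (q := 0) hr one_pos hp1).const_mul
    (‖q + 1‖ / (r / 2) ^ 2)
  have key := hasDerivAt_integral_of_dominated_loc_of_deriv_le (F' := F')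
    (F := fun (s t : ℝ) => (t : ℂ) ^ p * ((1 + t / s : ℝ) : ℂ) ^ (q + 1) * Complex.exp (-(t : ℂ)))
    (Ioi_mem_nhds (show r / 2 < r by linarith))
    (.of_forall fun s => aestronglyMeasurable_tricomiIntegrand s p (q + 1) _)
    (integrableOn_tricomiIntegrand hr hp (q + 1))
    ((aestronglyMeasurable_tricomiIntegrand r (p + 1) q _).const_mul _) ?_ hb ?_
  · have := key.2
    rwa [integral_const_mul] at this
  · refine (ae_restrict_iff' measurableSet_Ioi).2 (.of_forall fun t (ht : 0 < t) s hs => ?_)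
    have hs : r / 2 < s := hs
    have hs0 : 0 < s := by linarith
    rw [norm_mul, norm_tricomiIntegrand hs0 ht, norm_div, norm_neg, norm_pow, Complex.norm_real,
      Real.norm_of_nonneg hs0.le, Real.rpow_zero, neg_one_mul]
    gcongr
    exact Real.rpow_le_one_of_one_le_of_nonpos (by simp; positivity) hq
  · refine (ae_restrict_iff' measurableSet_Ioi).2 (.of_forall fun t (ht : 0 < t) s hs => ?_)
    have hs : r / 2 < s := hs
    have hs0 : 0 < s := by linarith
    have hs' : (s : ℂ) ≠ 0 := Complex.ofReal_ne_zero.2 hs0.ne'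
    have h1 : HasDerivAt (fun s : ℝ => 1 + t / s) (-t / s ^ 2) s := by
      have := ((hasDerivAt_inv hs0.ne').const_mul t).const_add 1
      refine this.congr_deriv ?_
      field_simp
    have h2 : HasDerivAt (fun z : ℂ => z ^ (q + 1))
        ((q + 1) * ((1 + t / s : ℝ) : ℂ) ^ (q + 1 - 1) * 1) ((1 + t / s : ℝ) : ℂ) :=
      (hasDerivAt_id _).cpow_const (Complex.ofReal_mem_slitPlane.2 (one_add_div_pos hs0 ht.le))
    have h3 := ((h2.scomp s h1.ofReal_comp).const_mul ((t : ℂ) ^ p)).mul_const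
      (Complex.exp (-(t : ℂ)))
    refine h3.congr_deriv ?_
    simp only [hF', add_sub_cancel_right, smul_eq_mul,
      Complex.cpow_add _ _ (Complex.ofReal_ne_zero.2 ht.ne'), Complex.cpow_one]
    push_cast
    field_simp

/-- Geometric control, relative to `(2ℓ)!`, of the integral in the direction `(1, 1)`. -/
lemma exists_norm_tricomiIntegral_le {r ρ : ℝ} {p : ℂ} (hr : 0 < r) (hρ : 0 < ρ) (hρ1 : ρ < 1)
    (hp : -1 < p.re) (q : ℂ) :
    ∃ C, 0 ≤ C ∧ ∀ ℓ : ℕ, ‖tricomiIntegral r (p + ℓ) (q + ℓ)‖ ≤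
      C * (2 * ℓ).factorial * (1 / (r * ρ ^ 2)) ^ ℓ := by
  have hI := integrableOn_rpow_mul_one_add_div_rpow_mul_exp (q := q.re) hr (sub_pos.2 hρ1) hp
  refine ⟨Real.exp (ρ * r / 2) * ∫ t in Set.Ioi (0 : ℝ),
    t ^ p.re * (1 + t / r) ^ q.re * Real.exp (-(1 - ρ) * t), ?_, fun ℓ => ?_⟩
  · refine mul_nonneg (Real.exp_pos _).le (setIntegral_nonneg measurableSet_Ioi fun t ht => ?_)
    have ht : 0 < t := ht
    positivity
  · have hB : Real.exp (ρ * r / 2) * (∫ t in Set.Ioi (0 : ℝ),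
        t ^ p.re * (1 + t / r) ^ q.re * Real.exp (-(1 - ρ) * t)) * (2 * ℓ).factorial *
          (1 / (r * ρ ^ 2)) ^ ℓ =
        ∫ t in Set.Ioi (0 : ℝ), (Real.exp (ρ * r / 2) * (2 * ℓ).factorial *
          (1 / (r * ρ ^ 2)) ^ ℓ) * (t ^ p.re * (1 + t / r) ^ q.re * Real.exp (-(1 - ρ) * t)) := by
      rw [integral_const_mul]; ring
    rw [hB]
    refine norm_integral_le_of_norm_le (hI.const_mul _) ?_
    refine (ae_restrict_iff' measurableSet_Ioi).2 (.of_forall fun t ht => ?_)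
    have ht : 0 < t := ht
    have h1 : (t * (1 + t / r)) ^ ℓ ≤ Real.exp (ρ * r / 2) * (2 * ℓ).factorial *
        (1 / (r * ρ ^ 2)) ^ ℓ * Real.exp (ρ * t) := by
      have h2 : t * (1 + t / r) ≤ 1 / (r * ρ ^ 2) * (ρ * (t + r / 2)) ^ 2 := by
        have : 1 / (r * ρ ^ 2) * (ρ * (t + r / 2)) ^ 2 = t * (1 + t / r) + r / 4 := by
          field_simp; ring
        rw [this]; linarith
      have h3 := Real.pow_div_factorial_le_exp (ρ * (t + r / 2)) (by positivity) (2 * ℓ)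
      rw [div_le_iff₀ (by positivity)] at h3
      calc (t * (1 + t / r)) ^ ℓ ≤ (1 / (r * ρ ^ 2) * (ρ * (t + r / 2)) ^ 2) ^ ℓ := by gcongr
        _ = (1 / (r * ρ ^ 2)) ^ ℓ * (ρ * (t + r / 2)) ^ (2 * ℓ) := by rw [mul_pow, pow_mul]
        _ ≤ (1 / (r * ρ ^ 2)) ^ ℓ * (Real.exp (ρ * (t + r / 2)) * (2 * ℓ).factorial) := by gcongr
        _ = (1 / (r * ρ ^ 2)) ^ ℓ *
            (Real.exp (ρ * r / 2) * Real.exp (ρ * t) * (2 * ℓ).factorial) := by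
          rw [← Real.exp_add]; ring_nf
        _ = _ := by ring
    have h4 : 0 < 1 + t / r := one_add_div_pos hr ht.le
    rw [norm_tricomiIntegrand hr ht]
    simp only [Complex.add_re, Complex.natCast_re]
    rw [Real.rpow_add_natCast ht.ne', Real.rpow_add_natCast h4.ne']
    calc t ^ p.re * t ^ ℓ * ((1 + t / r) ^ q.re * (1 + t / r) ^ ℓ) * Real.exp (-t)
        = t ^ p.re * (1 + t / r) ^ q.re * Real.exp (-t) * (t * (1 + t / r)) ^ ℓ := by
          rw [mul_pow]; ring
      _ ≤ t ^ p.re * (1 + t / r) ^ q.re * Real.exp (-t) *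
          (Real.exp (ρ * r / 2) * (2 * ℓ).factorial *
            (1 / (r * ρ ^ 2)) ^ ℓ * Real.exp (ρ * t)) := by gcongr
      _ = (Real.exp (ρ * r / 2) * (2 * ℓ).factorial * (1 / (r * ρ ^ 2)) ^ ℓ) *
          (t ^ p.re * (1 + t / r) ^ q.re * (Real.exp (-t) * Real.exp (ρ * t))) := by ring
      _ = _ := by rw [← Real.exp_add]; ring_nf

/-! ### Separating the elementary factors of the Whittaker functions -/

/-- `M_{κ,ℓ+1/2}` without its exponential factor. -/
def reducedM (κ : ℂ) (ℓ : ℕ) (z : ℂ) : ℂ :=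
  z ^ (ℓ + 1) * kummer ((ℓ : ℂ) + 1 - κ) (2 * (ℓ : ℂ) + 2) z

/-- `W_{κ,ℓ+1/2}` without its elementary and Gamma factors. -/
def reducedW (κ : ℂ) (ℓ : ℕ) (r : ℝ) : ℂ := tricomiIntegral r ((ℓ : ℂ) - κ) ((ℓ : ℂ) + κ)

lemma whittakerM_eq (κ : ℂ) (ℓ : ℕ) (z : ℂ) :
    whittakerM κ ℓ z = Complex.exp (-z / 2) * reducedM κ ℓ z :=
  mul_assoc _ _ _

lemma whittakerW_eq (κ : ℂ) (ℓ : ℕ) (r : ℝ) :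
    whittakerW κ ((ℓ : ℂ) + 1 / 2) r = Complex.exp (-(r : ℂ) / 2) * (r : ℂ) ^ κ *
      (Complex.Gamma ((ℓ : ℂ) + 1 - κ))⁻¹ * reducedW κ ℓ r := by
  have h1 : (ℓ : ℂ) + 1 / 2 - κ + 1 / 2 = ℓ + 1 - κ := by ring
  have h2 : (ℓ : ℂ) + 1 / 2 - κ - 1 / 2 = ℓ - κ := by ring
  have h3 : (ℓ : ℂ) + 1 / 2 + κ - 1 / 2 = ℓ + κ := by ring
  rw [whittakerW, h1, h2, h3, reducedW, tricomiIntegral]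

lemma two_mul_natCast_add_ne_zero (ℓ k : ℕ) (hk : k ≠ 0) : 2 * (ℓ : ℂ) + k ≠ 0 := by
  norm_cast
  omega

lemma one_le_re_two_mul_natCast_add_two (ℓ : ℕ) : 1 ≤ (2 * (ℓ : ℂ) + 2).re := by
  simp
  linarith [ℓ.cast_nonneg (α := ℝ)]

lemma reducedM_three_term (κ : ℂ) (ℓ : ℕ) {z : ℂ} (hz : z ≠ 0) :
    reducedM κ ℓ z =
      (1 / z + (ℓ + 2 - κ) / ((2 * ℓ + 3) * (2 * ℓ + 4)) -
        (ℓ + 1 + κ) / ((2 * ℓ + 2) * (2 * ℓ + 3))) * reducedM κ (ℓ + 1) z +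
      (ℓ + 2 - κ) * (ℓ + 2 + κ) / ((2 * ℓ + 3) * (2 * ℓ + 4) ^ 2 * (2 * ℓ + 5)) *
        reducedM κ (ℓ + 2) z := by
  have h := kummer_three_term (one_le_re_two_mul_natCast_add_two ℓ) ((ℓ : ℂ) + 1 - κ) z
  have e1 : (ℓ : ℂ) + 1 - κ + 1 = ℓ + 2 - κ := by ring
  have e2 : (ℓ : ℂ) + 1 - κ + 2 = ℓ + 2 + 1 - κ := by ring
  have e3 : 2 * (ℓ : ℂ) + 2 + 1 - (ℓ + 1 - κ) = ℓ + 2 + κ := by ring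
  have e4 : 2 * (ℓ : ℂ) + 2 - (ℓ + 1 - κ) = ℓ + 1 + κ := by ring
  have e5 : 2 * (ℓ : ℂ) + 2 + 1 = 2 * ℓ + 3 := by ring
  have e6 : 2 * (ℓ : ℂ) + 2 + 2 = 2 * ℓ + 4 := by ring
  have e7 : 2 * (ℓ : ℂ) + 2 + 3 = 2 * ℓ + 5 := by ring
  have e8 : 2 * (ℓ : ℂ) + 2 + 4 = 2 * (ℓ + 2) + 2 := by ring
  have e9 : 2 * ((ℓ : ℂ) + 1) + 2 = 2 * ℓ + 4 := by ring
  have e10 : (ℓ : ℂ) + 1 + 1 - κ = ℓ + 2 - κ := by ring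
  rw [e3, e1, e2, e4, e5, e6, e7, e8] at h
  simp only [reducedM]
  rw [h]
  push_cast
  rw [e9, e10]
  generalize kummer ((ℓ : ℂ) + 2 - κ) (2 * ℓ + 4) z = A
  generalize kummer ((ℓ : ℂ) + 2 + 1 - κ) (2 * (ℓ + 2) + 2) z = B
  have hz1 : 1 / z * z = 1 := one_div_mul_cancel hz
  linear_combination -(z ^ (ℓ + 1) * A) * hz1

lemma reducedW_three_term {κ : ℂ} (hκ : κ.re < 1) (ℓ : ℕ) {r : ℝ} (hr : 0 < r) :
    reducedW κ (ℓ + 2) r / (2 * ℓ + 4) =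
      (ℓ + 1 - κ) * (ℓ + 1 + κ) / (2 * ℓ + 2) * reducedW κ ℓ r +
      ((2 * ℓ + 3) / r - (ℓ + 1 + κ) / (2 * ℓ + 2) + (ℓ + 2 - κ) / (2 * ℓ + 4)) *
        reducedW κ (ℓ + 1) r := by
  have hp : -1 < ((ℓ : ℂ) - κ).re := by
    simp; linarith [ℓ.cast_nonneg (α := ℝ)]
  have s2 : (ℓ : ℂ) - κ + (ℓ + κ) + 2 = 2 * ℓ + 2 := by ring
  have s3 : (ℓ : ℂ) - κ + (ℓ + κ) + 3 = 2 * ℓ + 3 := by ring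
  have s4 : (ℓ : ℂ) - κ + (ℓ + κ) + 4 = 2 * ℓ + 4 := by ring
  have p1 : (ℓ : ℂ) - κ + 1 = ℓ + 1 - κ := by ring
  have p2 : (ℓ : ℂ) - κ + 2 = ℓ + 2 - κ := by ring
  have q1 : (ℓ : ℂ) + κ + 1 = ℓ + 1 + κ := by ring
  have q2 : (ℓ : ℂ) + κ + 2 = ℓ + 2 + κ := by ring
  have h := tricomiIntegral_three_term (q := (ℓ : ℂ) + κ) hr hp
    (by rw [s2]; exact_mod_cast two_mul_natCast_add_ne_zero ℓ 2 two_ne_zero)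
    (by rw [s4]; exact_mod_cast two_mul_natCast_add_ne_zero ℓ 4 four_ne_zero)
  rw [s2, s3, s4, p1, p2, q1, q2] at h
  simpa [reducedW] using h

/-! ### Telescoping -/

/-- The Casoratian-type quantity whose differences are the terms of the addition formula. -/
def casoratian (κ : ℂ) (z : ℂ) (r : ℝ) (ℓ : ℕ) : ℂ :=
  reducedM κ ℓ z * reducedW κ (ℓ + 1) r / ((2 * (ℓ + 1)).factorial : ℂ) +
    (ℓ + 1 - κ) * (ℓ + 1 + κ) / ((2 * ℓ + 2) * (2 * ℓ + 3) * ((2 * (ℓ + 1)).factorial : ℂ)) *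
      reducedM κ (ℓ + 1) z * reducedW κ ℓ r

lemma casoratian_sub_casoratian_succ {κ : ℂ} (hκ : κ.re < 1) {z : ℂ} (hz : z ≠ 0) {r : ℝ}
    (hr : 0 < r) (ℓ : ℕ) :
    casoratian κ z r ℓ - casoratian κ z r (ℓ + 1) =
      (1 / z - 1 / r) *
        (reducedM κ (ℓ + 1) z * reducedW κ (ℓ + 1) r / ((2 * (ℓ + 1)).factorial : ℂ)) := by
  have hM := reducedM_three_term κ ℓ hz
  have hW := reducedW_three_term hκ ℓ hr
  have hr' : (r : ℂ) ≠ 0 := Complex.ofReal_ne_zero.2 hr.ne'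
  have n2 : 2 * (ℓ : ℂ) + 2 ≠ 0 := by exact_mod_cast two_mul_natCast_add_ne_zero ℓ 2 two_ne_zero
  have n3 : 2 * (ℓ : ℂ) + 3 ≠ 0 := by exact_mod_cast two_mul_natCast_add_ne_zero ℓ 3 three_ne_zero
  have n4 : 2 * (ℓ : ℂ) + 4 ≠ 0 := by exact_mod_cast two_mul_natCast_add_ne_zero ℓ 4 four_ne_zero
  have n5 : 2 * (ℓ : ℂ) + 5 ≠ 0 := by exact_mod_cast two_mul_natCast_add_ne_zero ℓ 5 (by norm_num)
  have hn : ((2 * (ℓ + 1)).factorial : ℂ) ≠ 0 := by exact_mod_cast Nat.factorial_ne_zero _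
  have hfac : ((2 * (ℓ + 1 + 1)).factorial : ℂ) =
      (2 * ℓ + 4) * (2 * ℓ + 3) * ((2 * (ℓ + 1)).factorial : ℂ) := by
    have : 2 * (ℓ + 1 + 1) = 2 * (ℓ + 1) + 1 + 1 := by ring
    rw [this, Nat.factorial_succ, Nat.factorial_succ]
    push_cast
    ring
  have c1 : (ℓ : ℂ) + 1 + 1 = ℓ + 2 := by ring
  have c2 : 2 * ((ℓ : ℂ) + 1) + 2 = 2 * ℓ + 4 := by ring
  have c3 : 2 * ((ℓ : ℂ) + 1) + 3 = 2 * ℓ + 5 := by ring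
  rw [div_eq_iff n4] at hW
  simp only [casoratian]
  rw [hfac]
  push_cast
  rw [c1, c2, c3, show ℓ + 1 + 1 = ℓ + 2 from rfl, hM, hW]
  generalize ((2 * (ℓ + 1)).factorial : ℂ) = N at hn
  obtain ⟨b, hb⟩ : ∃ b : ℂ, b = 2 * ℓ + 2 := ⟨_, rfl⟩
  have b3 : 2 * (ℓ : ℂ) + 3 = b + 1 := by rw [hb]; ring
  have b4 : 2 * (ℓ : ℂ) + 4 = b + 2 := by rw [hb]; ring
  have b5 : 2 * (ℓ : ℂ) + 5 = b + 3 := by rw [hb]; ring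
  have b1 : (ℓ : ℂ) = b / 2 - 1 := by rw [hb]; ring
  rw [← hb] at n2
  rw [b3] at n3
  rw [b4] at n4
  rw [b5] at n5
  rw [b3, b4, b5, ← hb, b1]
  field_simp
  ring

lemma hasDerivAt_reducedM_zero (κ z : ℂ) (hz : z ≠ 0) :
    HasDerivAt (reducedM κ 0)
      ((1 / z + (1 - κ) / 2) * reducedM κ 0 z + (1 - κ) * (1 + κ) / 12 * reducedM κ 1 z) z := by
  have hb : 1 ≤ (2 : ℂ).re := by simp
  have h1 : HasDerivAt (fun w => w ^ 1 * kummer (1 - κ) 2 w) _ z :=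
    (hasDerivAt_pow 1 z).mul (hasDerivAt_kummer hb (1 - κ) z)
  have e1 : reducedM κ 0 = fun w => w ^ 1 * kummer (1 - κ) 2 w := by
    ext w; simp [reducedM]
  have h2 := kummer_add_one_add_one hb (1 - κ) z
  have e2 : reducedM κ 1 z = z ^ 2 * kummer (1 - κ + 1) (2 + 2) z := by
    simp only [reducedM]
    push_cast
    ring_nf
  rw [e2, e1]
  refine h1.congr_deriv ?_
  rw [h2]
  field_simp
  push_cast
  ring

lemma hasDerivAt_reducedW_zero {κ : ℂ} (hκ : κ.re < 1) {r : ℝ} (hr : 0 < r) :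
    HasDerivAt (reducedW κ 0)
      ((1 - κ) * (1 / 2 + 1 / r) * reducedW κ 0 r - reducedW κ 1 r / 2) r := by
  have hp : -1 < (-κ).re := by simpa using hκ
  have hp1 : -1 < (-κ + 1).re := by simp; linarith
  have h := hasDerivAt_tricomiIntegral (q := κ - 1) hr hp (by simp; linarith)
  have e0 : reducedW κ 0 = fun s => tricomiIntegral s (-κ) (κ - 1 + 1) := by
    ext s; simp [reducedW]
  have e1 : reducedW κ 1 r = tricomiIntegral r (-κ + 1) (κ + 1) := by
    simp only [reducedW]; push_cast; ring_nf
  have s1 := tricomiIntegral_succ hr hp κ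
  have s2 := tricomiIntegral_add_one_add_one hr hp (κ - 1)
  have hr' : (r : ℂ) ≠ 0 := Complex.ofReal_ne_zero.2 hr.ne'
  rw [sub_add_cancel] at s2 h e0
  rw [e1, e0]
  refine h.congr_deriv ?_
  rw [s1, s2]
  field_simp
  ring

/-! ### Convergence -/

lemma norm_reducedM_le {κ : ℂ} {ℓ : ℕ} (hℓ : ‖κ‖ ≤ ℓ) (z : ℂ) :
    ‖reducedM κ ℓ z‖ ≤ ‖z‖ ^ (ℓ + 1) * Real.exp ‖z‖ := by
  rw [reducedM, norm_mul, norm_pow]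
  gcongr
  refine norm_kummer_le_exp (one_le_re_two_mul_natCast_add_two ℓ) (fun k => ?_) z
  have h1 : ‖2 * (ℓ : ℂ) + 2 + k‖ = 2 * ℓ + 2 + k := by
    have : 2 * (ℓ : ℂ) + 2 + k = ((2 * ℓ + 2 + k : ℕ) : ℂ) := by push_cast; ring
    rw [this, Complex.norm_natCast]
    push_cast
    ring
  have h2 : (ℓ : ℂ) + 1 - κ + k = ((ℓ + 1 + k : ℕ) : ℂ) - κ := by push_cast; ring
  have h3 := norm_sub_le ((ℓ + 1 + k : ℕ) : ℂ) κ
  rw [Complex.norm_natCast] at h3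
  rw [h1, h2]
  push_cast at h3 ⊢
  linarith

lemma exists_norm_reducedW_le {κ : ℂ} (hκ : κ.re < 1) {x r : ℝ} (hx : 0 < x) (hr : x < r) :
    ∃ C B : ℝ, 0 ≤ C ∧ 0 ≤ B ∧ x * B < 1 ∧
      ∀ ℓ : ℕ, ‖reducedW κ ℓ r‖ ≤ C * (2 * ℓ).factorial * B ^ ℓ := by
  have hr0 : 0 < r := hx.trans hr
  obtain ⟨ρ, h1, h2⟩ := exists_between (show √(x / r) < 1 by
    rw [Real.sqrt_lt' one_pos, one_pow, div_lt_one hr0]; exact hr)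
  have hρ : 0 < ρ := (Real.sqrt_nonneg _).trans_lt h1
  obtain ⟨C, hC, h⟩ := exists_norm_tricomiIntegral_le (p := -κ) hr0 hρ h2 (by simpa using hκ) κ
  refine ⟨C, 1 / (r * ρ ^ 2), hC, by positivity, ?_, fun ℓ => ?_⟩
  · rw [Real.sqrt_lt' hρ, div_lt_iff₀ hr0] at h1
    rw [mul_one_div, div_lt_one (by positivity)]
    linarith
  · convert h ℓ using 2
    rw [reducedW]
    ring_nf

lemma summable_reducedM_mul_reducedW {κ : ℂ} (hκ : κ.re < 1) {x r : ℝ} (hx : 0 < x)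
    (hr : x < r) :
    Summable fun ℓ : ℕ => reducedM κ ℓ x * reducedW κ ℓ r / ((2 * ℓ).factorial : ℂ) := by
  obtain ⟨C, B, hC, hB, hxB, hW⟩ := exists_norm_reducedW_le hκ hx hr
  obtain ⟨L, hL⟩ := exists_nat_ge ‖κ‖
  refine .of_norm_bounded_eventually_nat
    ((summable_geometric_of_lt_one (by positivity) hxB).mul_left (x * Real.exp x * C)) ?_
  filter_upwards [Filter.eventually_ge_atTop L] with ℓ hℓ
  have hM := norm_reducedM_le (hL.trans (Nat.cast_le.2 hℓ)) (x : ℂ)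
  rw [Complex.norm_real, Real.norm_of_nonneg hx.le] at hM
  rw [norm_div, norm_mul, Complex.norm_natCast, div_le_iff₀ (by positivity)]
  calc ‖reducedM κ ℓ x‖ * ‖reducedW κ ℓ r‖
      ≤ (x ^ (ℓ + 1) * Real.exp x) * (C * (2 * ℓ).factorial * B ^ ℓ) := by
        gcongr
        exact hW ℓ
    _ = _ := by rw [mul_pow]; ring

lemma tendsto_casoratian {κ : ℂ} (hκ : κ.re < 1) {x r : ℝ} (hx : 0 < x) (hr : x < r) :
    Filter.Tendsto (casoratian κ x r) Filter.atTop (nhds 0) := by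
  obtain ⟨C, B, hC, hB, hxB, hW⟩ := exists_norm_reducedW_le hκ hx hr
  obtain ⟨L, hL⟩ := exists_nat_ge ‖κ‖
  have hlim := (tendsto_pow_atTop_nhds_zero_of_lt_one (by positivity) hxB).const_mul
    (Real.exp x * C * (x * B + x ^ 2))
  rw [mul_zero] at hlim
  refine squeeze_zero_norm' ?_ hlim
  filter_upwards [Filter.eventually_ge_atTop L] with ℓ hℓ
  have hκℓ : ‖κ‖ ≤ ℓ := hL.trans (Nat.cast_le.2 hℓ)
  have hM := norm_reducedM_le hκℓ (x : ℂ)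
  have hM' := norm_reducedM_le (ℓ := ℓ + 1) (hκℓ.trans (by simp)) (x : ℂ)
  rw [Complex.norm_real, Real.norm_of_nonneg hx.le] at hM hM'
  have hN : (0 : ℝ) < (2 * (ℓ + 1)).factorial := by positivity
  have hfac : ((2 * ℓ).factorial : ℝ) ≤ (2 * (ℓ + 1)).factorial := by
    exact_mod_cast Nat.factorial_le (by omega)
  have n1 : ‖(ℓ : ℂ) + 1‖ = ℓ + 1 := by
    rw [← Nat.cast_succ, Complex.norm_natCast, Nat.cast_succ]
  have n2 : ‖2 * (ℓ : ℂ) + 2‖ = 2 * ℓ + 2 := by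
    have : 2 * (ℓ : ℂ) + 2 = ((2 * ℓ + 2 : ℕ) : ℂ) := by push_cast; ring
    rw [this, Complex.norm_natCast]; push_cast; ring
  have n3 : ‖2 * (ℓ : ℂ) + 3‖ = 2 * ℓ + 3 := by
    have : 2 * (ℓ : ℂ) + 3 = ((2 * ℓ + 3 : ℕ) : ℂ) := by push_cast; ring
    rw [this, Complex.norm_natCast]; push_cast; ring
  have a1 : ‖(ℓ : ℂ) + 1 - κ‖ ≤ 2 * ℓ + 2 := by
    have := norm_sub_le ((ℓ : ℂ) + 1) κ
    rw [n1] at this; linarith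
  have a2 : ‖(ℓ : ℂ) + 1 + κ‖ ≤ 2 * ℓ + 3 := by
    have := norm_add_le ((ℓ : ℂ) + 1) κ
    rw [n1] at this; linarith
  have t1 : ‖reducedM κ ℓ x * reducedW κ (ℓ + 1) r / ((2 * (ℓ + 1)).factorial : ℂ)‖ ≤
      Real.exp x * C * (x * B) * (x * B) ^ ℓ := by
    rw [norm_div, norm_mul, Complex.norm_natCast, div_le_iff₀ hN]
    calc ‖reducedM κ ℓ x‖ * ‖reducedW κ (ℓ + 1) r‖
        ≤ (x ^ (ℓ + 1) * Real.exp x) * (C * (2 * (ℓ + 1)).factorial * B ^ (ℓ + 1)) := by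
          gcongr
          exact hW (ℓ + 1)
      _ = _ := by rw [mul_pow]; ring
  have t2 : ‖(ℓ + 1 - κ) * (ℓ + 1 + κ) /
      ((2 * ℓ + 2) * (2 * ℓ + 3) * ((2 * (ℓ + 1)).factorial : ℂ)) *
      reducedM κ (ℓ + 1) x * reducedW κ ℓ r‖ ≤ Real.exp x * C * x ^ 2 * (x * B) ^ ℓ := by
    rw [norm_mul, norm_mul, norm_div, norm_mul, norm_mul, norm_mul, n2, n3, Complex.norm_natCast]
    calc ‖(ℓ : ℂ) + 1 - κ‖ * ‖(ℓ : ℂ) + 1 + κ‖ /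
          ((2 * ℓ + 2) * (2 * ℓ + 3) * (2 * (ℓ + 1)).factorial) *
          ‖reducedM κ (ℓ + 1) x‖ * ‖reducedW κ ℓ r‖
        ≤ (2 * ℓ + 2) * (2 * ℓ + 3) / ((2 * ℓ + 2) * (2 * ℓ + 3) * (2 * (ℓ + 1)).factorial) *
          (x ^ (ℓ + 1 + 1) * Real.exp x) * (C * (2 * (ℓ + 1)).factorial * B ^ ℓ) := by
          gcongr
          refine (hW ℓ).trans ?_
          gcongr
      _ = _ := by rw [mul_pow]; field_simp; ring
  refine (norm_add_le _ _).trans ((add_le_add t1 t2).trans_eq ?_)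
  ring

/-- The telescoped series, expressed through the reduced functions. -/
lemma hasSum_reducedM_mul_reducedW {κ : ℂ} (hκ : κ.re < 1) {x r : ℝ} (hx : 0 < x) (hr : x < r) :
    HasSum (fun ℓ : ℕ => (1 / (x : ℂ) - 1 / r) *
        (reducedM κ ℓ x * reducedW κ ℓ r / ((2 * ℓ).factorial : ℂ)))
      ((1 / (x : ℂ) - 1 / r) * (reducedM κ 0 x * reducedW κ 0 r) + casoratian κ x r 0) := by
  have hx' : (x : ℂ) ≠ 0 := Complex.ofReal_ne_zero.2 hx.ne'
  rw [((summable_reducedM_mul_reducedW hκ hx hr).mul_left _).hasSum_iff_tendsto_nat,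
    ← Filter.tendsto_add_atTop_iff_nat 1]
  have hpartial (n : ℕ) : ∑ ℓ ∈ Finset.range (n + 1), (1 / (x : ℂ) - 1 / r) *
      (reducedM κ ℓ x * reducedW κ ℓ r / ((2 * ℓ).factorial : ℂ)) =
      (1 / (x : ℂ) - 1 / r) * (reducedM κ 0 x * reducedW κ 0 r) + casoratian κ x r 0 -
        casoratian κ x r n := by
    rw [Finset.sum_range_succ']
    simp_rw [← casoratian_sub_casoratian_succ hκ hx' (hx.trans hr)]
    rw [Finset.sum_range_sub']
    simp
    ring
  simp_rw [hpartial]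
  simpa using (tendsto_casoratian hκ hx hr).const_sub
    ((1 / (x : ℂ) - 1 / r) * (reducedM κ 0 x * reducedW κ 0 r) + casoratian κ x r 0)

lemma deriv_whittakerM_zero (κ : ℂ) {z : ℂ} (hz : z ≠ 0) :
    deriv (whittakerM κ 0) z = Complex.exp (-z / 2) *
      ((1 / z - κ / 2) * reducedM κ 0 z + (1 - κ) * (1 + κ) / 12 * reducedM κ 1 z) := by
  have h1 : HasDerivAt (fun w : ℂ => Complex.exp (-w / 2)) _ z :=
    ((hasDerivAt_id z).neg.div_const 2).cexp
  have h2 := h1.mul (hasDerivAt_reducedM_zero κ z hz)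
  have h3 : whittakerM κ 0 = (fun w : ℂ => Complex.exp (-w / 2)) * reducedM κ 0 :=
    funext fun w => whittakerM_eq κ 0 w
  rw [h3, h2.deriv]
  simp
  ring

lemma deriv_whittakerW_half {κ : ℂ} (hκ : κ.re < 1) {r : ℝ} (hr : 0 < r) :
    deriv (whittakerW κ (1 / 2)) r = Complex.exp (-(r : ℂ) / 2) * (r : ℂ) ^ κ *
      (Complex.Gamma (1 - κ))⁻¹ *
      ((1 / r - κ / 2) * reducedW κ 0 r - reducedW κ 1 r / 2) := by
  have hr' : (r : ℂ) ≠ 0 := Complex.ofReal_ne_zero.2 hr.ne'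
  have h1 : HasDerivAt (fun s : ℝ => Complex.exp (-(s : ℂ) / 2))
      (Complex.exp (-(r : ℂ) / 2) * (-1 / 2)) r :=
    ((Complex.ofRealCLM.hasDerivAt (x := r)).neg.div_const 2).cexp.congr_deriv (by simp)
  have h2 : HasDerivAt (fun s : ℝ => (s : ℂ) ^ κ) (κ * (r : ℂ) ^ κ / r) r := by
    have e : HasDerivAt (fun z : ℂ => z ^ κ) (κ * (r : ℂ) ^ (κ - 1) * 1) (r : ℂ) :=
      (hasDerivAt_id _).cpow_const (Complex.ofReal_mem_slitPlane.2 hr)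
    refine e.comp_ofReal.congr_deriv ?_
    rw [Complex.cpow_sub _ _ hr', Complex.cpow_one]
    ring
  have h3 := ((h1.mul h2).mul_const (Complex.Gamma (1 - κ))⁻¹).mul (hasDerivAt_reducedW_zero hκ hr)
  have h4 : whittakerW κ (1 / 2) = fun s : ℝ => Complex.exp (-(s : ℂ) / 2) * (s : ℂ) ^ κ *
      (Complex.Gamma (1 - κ))⁻¹ * reducedW κ 0 s := by
    ext s
    simpa using whittakerW_eq κ 0 s
  rw [h4]
  refine h3.deriv.trans ?_
  simp only [Pi.mul_apply]
  field_simp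
  ring

/-- The `γ = 0` special case of the addition formula for the Whittaker functions. -/
theorem whittaker_addition_formula_gamma_zero (κ : ℂ) (hκ : κ.re < 1) (r₀ r : ℝ)
    (hr₀ : 0 < r₀) (hr : r₀ < r) :
    HasSum
      (fun ℓ : ℕ =>
        (1 / (r * r₀ : ℂ)) *
          (Complex.Gamma ((ℓ : ℂ) + 1 - κ) / ((2 * ℓ).factorial : ℂ)) *
          whittakerM κ ℓ (r₀ : ℂ) * whittakerW κ ((ℓ : ℂ) + 1 / 2) r)
      ((Complex.Gamma (1 - κ) / (r - r₀ : ℂ)) *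
        (deriv (whittakerM κ 0) (r₀ : ℂ) * whittakerW κ (1 / 2) r -
          whittakerM κ 0 (r₀ : ℂ) * deriv (whittakerW κ (1 / 2)) r)) := by
  have hr0 : 0 < r := hr₀.trans hr
  have hx' : (r₀ : ℂ) ≠ 0 := Complex.ofReal_ne_zero.2 hr₀.ne'
  have hr' : (r : ℂ) ≠ 0 := Complex.ofReal_ne_zero.2 hr0.ne'
  have hsub : (r : ℂ) - r₀ ≠ 0 := by
    rw [← Complex.ofReal_sub]
    exact Complex.ofReal_ne_zero.2 (sub_pos.2 hr).ne'
  have hΓ (ℓ : ℕ) : Complex.Gamma ((ℓ : ℂ) + 1 - κ) ≠ 0 := by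
    refine Complex.Gamma_ne_zero_of_re_pos ?_
    simp
    linarith [ℓ.cast_nonneg (α := ℝ)]
  have hΓ0 : Complex.Gamma (1 - κ) ≠ 0 := by simpa using hΓ 0
  have hW0 : whittakerW κ (1 / 2) r = Complex.exp (-(r : ℂ) / 2) * (r : ℂ) ^ κ *
      (Complex.Gamma (1 - κ))⁻¹ * reducedW κ 0 r := by
    simpa using whittakerW_eq κ 0 r
  convert (hasSum_reducedM_mul_reducedW hκ hr₀ hr).mul_left
    (Complex.exp (-(r₀ : ℂ) / 2) * Complex.exp (-(r : ℂ) / 2) * (r : ℂ) ^ κ / (r - r₀)) using 1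
  · rfl
  · ext ℓ
    have hN : ((2 * ℓ).factorial : ℂ) ≠ 0 := by exact_mod_cast Nat.factorial_ne_zero _
    have := hΓ ℓ
    rw [whittakerM_eq, whittakerW_eq]
    field_simp
  · rw [deriv_whittakerM_zero κ hx', deriv_whittakerW_half hκ hr0, hW0, whittakerM_eq, casoratian]
    norm_num [Nat.factorial]
    field_simp
    ring
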